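/- arXiv:2209.10660 — 2 statements merged into one kernel-verified Lean document; each statement's English description precedes it below -/
import Mathlib

section
/- Let (Γ, 𝓑, ν₀) be a measure space and g : Γ → ℝ measurable with Z := ∫_Γ e^{g} dν₀ satisfying 0 < Z < ∞ and x ↦ g(x)e^{g(x)} ν₀-integrable. Let f_g := e^{g}/Z be the Gibbs density. Suppose f : Γ → ℝ is a measurable nonnegative function with ∫_Γ f dν₀ = 1, such that x ↦ f(x) log f(x) and x ↦ g(x) f(x) are ν₀-integrable and ∫_Γ g f dν₀ = ∫_Γ g f_g dν₀ (same observation value). Then −∫_Γ f log f dν₀ ≤ −∫_Γ f_g log f_g dν₀, i.e. among all probability densities with the given observation of g, the Gibbs density maximizes the relative entropy. (The entropy maximum principle characterizing thermodynamic equilibrium, Proposition 9.2 / Corollary 9.3(1).) -/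
open MeasureTheory

theorem Real.mul_log_sub_mul_log_le_sub {p q : ℝ} (hp : 0 ≤ p) (hq : 0 < q) :
    p * Real.log q - p * Real.log p ≤ q - p := by
  rcases hp.eq_or_lt with rfl | hp
  · simpa using hq.le
  · have h := mul_le_mul_of_nonneg_left (Real.log_le_sub_one_of_pos (div_pos hq hp)) hp.le
    rw [Real.log_div hq.ne' hp.ne'] at h
    have hpq : p * (q / p) = q := mul_div_cancel₀ q hp.ne'
    linarith

/-- **Gibbs' inequality**: the entropy of a density is at most its cross-entropy relative to any
other positive density. -/
theorem MeasureTheory.integral_mul_log_le_integral_mul_log {α : Type*} [MeasurableSpace α]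
    {μ : Measure α} {p q : α → ℝ} (hp0 : ∀ x, 0 ≤ p x) (hq0 : ∀ x, 0 < q x)
    (hp : Integrable p μ) (hq : Integrable q μ) (hpq : ∫ x, q x ∂μ = ∫ x, p x ∂μ)
    (hplog : Integrable (fun x => p x * Real.log (p x)) μ)
    (hqlog : Integrable (fun x => p x * Real.log (q x)) μ) :
    ∫ x, p x * Real.log (q x) ∂μ ≤ ∫ x, p x * Real.log (p x) ∂μ := by
  have h := integral_mono (hqlog.sub hplog) (hq.sub hp)
    fun x => Real.mul_log_sub_mul_log_le_sub (hp0 x) (hq0 x)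
  rw [integral_sub' hqlog hplog, integral_sub' hq hp] at h
  linarith

/-- **The entropy maximum principle** (Proposition 9.2 / Corollary 9.3(1)).
Among all probability densities `f` with the same observation `∫ g f dν₀` of the
observable `g`, the Gibbs density `f_g = e^g / Z` maximizes the relative entropy
`−∫ f log f dν₀`. -/
theorem entropy_le_entropy_gibbs {Γ : Type*} [MeasurableSpace Γ] (ν₀ : Measure Γ)
    (g : Γ → ℝ) (hg : Measurable g)
    (hexp : Integrable (fun x => Real.exp (g x)) ν₀)
    (Z : ℝ) (hZ : Z = ∫ x, Real.exp (g x) ∂ν₀) (hZpos : 0 < Z)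
    (hgexp : Integrable (fun x => g x * Real.exp (g x)) ν₀)
    (f : Γ → ℝ) (hfmeas : Measurable f) (hf0 : ∀ x, 0 ≤ f x)
    (hf1 : ∫ x, f x ∂ν₀ = 1)
    (hflog : Integrable (fun x => f x * Real.log (f x)) ν₀)
    (hgf : Integrable (fun x => g x * f x) ν₀)
    (hobs : ∫ x, g x * f x ∂ν₀ = ∫ x, g x * (Real.exp (g x) / Z) ∂ν₀) :
    -∫ x, f x * Real.log (f x) ∂ν₀
      ≤ -∫ x, (Real.exp (g x) / Z) * Real.log (Real.exp (g x) / Z) ∂ν₀ := by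
  have hf : Integrable f ν₀ := by
    by_contra h
    simp [integral_undef h] at hf1
  have hgibbs : ∫ x, Real.exp (g x) / Z ∂ν₀ = 1 := by
    rw [integral_div, ← hZ, div_self hZpos.ne']
  have hlog : ∀ x, Real.log (Real.exp (g x) / Z) = g x - Real.log Z := fun x => by
    rw [Real.log_div (Real.exp_ne_zero _) hZpos.ne', Real.log_exp]
  have hcross : ∀ x, f x * Real.log (Real.exp (g x) / Z) = g x * f x - Real.log Z * f x :=
    fun x => by rw [hlog]; ring
  have hself : ∀ x, Real.exp (g x) / Z * Real.log (Real.exp (g x) / Z) =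
      g x * (Real.exp (g x) / Z) - Real.log Z * (Real.exp (g x) / Z) :=
    fun x => by rw [hlog]; ring
  have hggibbs : Integrable (fun x => g x * (Real.exp (g x) / Z)) ν₀ := by
    simpa only [mul_div_assoc] using hgexp.div_const Z
  have hcrossint : Integrable (fun x => f x * Real.log (Real.exp (g x) / Z)) ν₀ := by
    simp only [hcross]
    exact hgf.sub (hf.const_mul (Real.log Z))
  have heq : ∫ x, f x * Real.log (Real.exp (g x) / Z) ∂ν₀ =
      ∫ x, Real.exp (g x) / Z * Real.log (Real.exp (g x) / Z) ∂ν₀ := by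
    simp only [hcross, hself]
    rw [integral_sub hgf (hf.const_mul _),
      integral_sub hggibbs ((hexp.div_const Z).const_mul _), integral_const_mul,
      integral_const_mul, hf1, hgibbs, hobs]
  rw [← heq]
  exact neg_le_neg (integral_mul_log_le_integral_mul_log hf0
    (fun x => div_pos (Real.exp_pos _) hZpos) hf (hexp.div_const Z) (hgibbs.trans hf1.symm)
    hflog hcrossint)
end

section
/- Let (Γ, 𝓑, ν₀) be a nonzero measure space and F : Γ → ℝ measurable. Suppose I ⊆ ℝ is an open interval such that for every λ ∈ I the functions x ↦ e^{λ F(x)} and x ↦ F(x) e^{λ F(x)} are ν₀-integrable, and ∫_Γ e^{λ F} dν₀ > 0. Then for every λ₀ ∈ I the log-partition function w(λ) := log ∫_Γ e^{λ F} dν₀ is differentiable at λ₀ with derivative w'(λ₀) = (∫_Γ F e^{λ₀ F} dν₀) / (∫_Γ e^{λ₀ F} dν₀), i.e. the derivative of w equals the observation ⟨F⟩ with respect to the Gibbs density e^{λ₀F}/∫e^{λ₀F}dν₀. (Corollary 9.3(2): q(λ) = ∂w/∂λ.) -/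
open MeasureTheory

/-- **Corollary 9.3(2): `q(λ) = ∂w/∂λ`.** On an open interval where the relevant
integrability holds, the log-partition function `w(λ) = log ∫ e^{λF} dν₀` is
differentiable, with derivative the Gibbs observation
`⟨F⟩ = (∫ F e^{λ₀F} dν₀) / (∫ e^{λ₀F} dν₀)`. -/
theorem hasDerivAt_logPartition {Γ : Type*} [MeasurableSpace Γ]
    (ν₀ : Measure Γ) (hν₀ : ν₀ ≠ 0)
    (F : Γ → ℝ) (hF : Measurable F)
    (I : Set ℝ) (hI : IsOpen I)
    (hexp : ∀ l ∈ I, Integrable (fun x => Real.exp (l * F x)) ν₀)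
    (hFexp : ∀ l ∈ I, Integrable (fun x => F x * Real.exp (l * F x)) ν₀)
    (hpos : ∀ l ∈ I, 0 < ∫ x, Real.exp (l * F x) ∂ν₀)
    (l₀ : ℝ) (hl₀ : l₀ ∈ I) :
    HasDerivAt (fun l => Real.log (∫ x, Real.exp (l * F x) ∂ν₀))
      ((∫ x, F x * Real.exp (l₀ * F x) ∂ν₀) / (∫ x, Real.exp (l₀ * F x) ∂ν₀)) l₀ := by
  have hmem : l₀ ∈ interior (ProbabilityTheory.integrableExpSet F ν₀) :=
    interior_maximal (fun l hl => hexp l hl) hI hl₀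
  exact (ProbabilityTheory.hasDerivAt_mgf hmem).log (hpos l₀ hl₀).ne'
end
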